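/- Let λ₀ satisfy λ₀‖ε‖_n ≥ ‖Xᵀε‖_∞/n, let η := √2 − 1, and suppose λη > λ₀ and ‖β⁰‖₁ ≤ ‖ε‖_n·(λη − λ₀)/(2λ₀λ). Set L := (λη + λ₀)/(λη − λ₀). Then for every β ∈ ℝᵖ with active set S := S_β such that φ̂(L,S) > 0, the square-root Lasso β̂ satisfies ‖X(β̂−β⁰)‖_n² ≤ ‖X(β−β⁰)‖_n² + ((λη+λ₀)/η)²·((λη+λ₀)/(2λ₀))²·‖ε‖_n²·|S| / φ̂²(L,S). -/

import Mathlib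

open Finset Matrix

/-- `‖v‖_n = √(vᵀv/n)`. -/
noncomputable def normN {n : ℕ} (v : Fin n → ℝ) : ℝ :=
  Real.sqrt ((∑ i, v i ^ 2) / n)

/-- `ℓ₁`-norm of a vector. -/
noncomputable def l1norm {p : ℕ} (v : Fin p → ℝ) : ℝ := ∑ j, |v j|

/-- `ℓ_∞`-norm of a vector. -/
noncomputable def lsup {p : ℕ} (v : Fin p → ℝ) : ℝ := ⨆ j, |v j|

/-- `β_S`: the vector `β` with entries outside `S` set to zero. -/
def sub0 {p : ℕ} (S : Finset (Fin p)) (β : Fin p → ℝ) : Fin p → ℝ :=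
  fun j => if j ∈ S then β j else 0

/-- The compatibility constant squared `φ̂²(L,S)`. -/
noncomputable def compatSq {n p : ℕ} (X : Matrix (Fin n) (Fin p) ℝ) (L : ℝ)
    (S : Finset (Fin p)) : ℝ :=
  sInf { r | ∃ β : Fin p → ℝ, l1norm (sub0 S β) = 1 ∧ l1norm (sub0 Sᶜ β) ≤ L ∧
    r = S.card * (normN (X.mulVec (sub0 S β) - X.mulVec (sub0 Sᶜ β))) ^ 2 }

/-- The normalized inner product `uᵀv/n`. -/
noncomputable def innerN {n : ℕ} (u v : Fin n → ℝ) : ℝ := (∑ i, u i * v i) / n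

lemma normN_nonneg {n : ℕ} (v : Fin n → ℝ) : 0 ≤ normN v := Real.sqrt_nonneg _

lemma normN_sq {n : ℕ} (v : Fin n → ℝ) : normN v ^ 2 = innerN v v := by
  have h : (0 : ℝ) ≤ (∑ i, v i ^ 2) / n := by positivity
  rw [normN, Real.sq_sqrt h, innerN]
  simp only [sq]

lemma innerN_comm {n : ℕ} (u v : Fin n → ℝ) : innerN u v = innerN v u := by
  simp only [innerN, mul_comm]

lemma innerN_sub_left {n : ℕ} (u v w : Fin n → ℝ) :
    innerN (u - v) w = innerN u w - innerN v w := by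
  simp only [innerN, Pi.sub_apply, sub_mul, Finset.sum_sub_distrib, sub_div]

lemma innerN_smul_left {n : ℕ} (c : ℝ) (u v : Fin n → ℝ) :
    innerN (c • u) v = c * innerN u v := by
  simp only [innerN, Pi.smul_apply, smul_eq_mul, mul_assoc, ← Finset.mul_sum, mul_div_assoc]

lemma normN_smul_sq {n : ℕ} (c : ℝ) (v : Fin n → ℝ) :
    normN (c • v) ^ 2 = c ^ 2 * normN v ^ 2 := by
  rw [normN_sq, normN_sq, innerN_smul_left, innerN_comm, innerN_smul_left]
  ring

lemma normN_sub_sq {n : ℕ} (u v : Fin n → ℝ) :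
    normN (u - v) ^ 2 = normN u ^ 2 - 2 * innerN u v + normN v ^ 2 := by
  simp only [normN_sq]
  rw [innerN_sub_left, innerN_comm u (u - v), innerN_comm v (u - v), innerN_sub_left,
    innerN_sub_left, innerN_comm v u]
  ring

lemma l1norm_nonneg {p : ℕ} (v : Fin p → ℝ) : 0 ≤ l1norm v :=
  Finset.sum_nonneg fun _ _ => abs_nonneg _

lemma l1norm_smul {p : ℕ} (c : ℝ) (v : Fin p → ℝ) : l1norm (c • v) = |c| * l1norm v := by
  simp only [l1norm, Pi.smul_apply, smul_eq_mul, abs_mul, Finset.mul_sum]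

lemma l1norm_add_le {p : ℕ} (u v : Fin p → ℝ) : l1norm (u + v) ≤ l1norm u + l1norm v := by
  simp only [l1norm, ← Finset.sum_add_distrib]
  exact Finset.sum_le_sum fun j _ => abs_add_le _ _

lemma l1norm_sub_le {p : ℕ} (u v : Fin p → ℝ) : l1norm (u - v) ≤ l1norm u + l1norm v := by
  simp only [l1norm, ← Finset.sum_add_distrib]
  exact Finset.sum_le_sum fun j _ => abs_sub _ _

lemma eq_zero_of_l1norm_nonpos {p : ℕ} {v : Fin p → ℝ} (h : l1norm v ≤ 0) : v = 0 := by
  have h0 : l1norm v = 0 := le_antisymm h (l1norm_nonneg v)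
  rw [l1norm, Finset.sum_eq_zero_iff_of_nonneg fun _ _ => abs_nonneg _] at h0
  ext j
  simpa using h0 j (Finset.mem_univ j)

lemma l1norm_sub0_add_compl {p : ℕ} (S : Finset (Fin p)) (v : Fin p → ℝ) :
    l1norm (sub0 S v) + l1norm (sub0 Sᶜ v) = l1norm v := by
  simp only [l1norm, ← Finset.sum_add_distrib]
  refine Finset.sum_congr rfl fun j _ => ?_
  by_cases hj : j ∈ S <;> simp [sub0, hj]

lemma sub0_add_compl {p : ℕ} (S : Finset (Fin p)) (v : Fin p → ℝ) :
    sub0 S v + sub0 Sᶜ v = v := by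
  ext j
  by_cases hj : j ∈ S <;> simp [sub0, hj]

/-- The `ℓ₁`-norm is decomposable over the support of `β`. -/
lemma l1norm_sub_l1norm_le {p : ℕ} {S : Finset (Fin p)} {β : Fin p → ℝ}
    (hS : ∀ j, j ∉ S → β j = 0) (γ : Fin p → ℝ) :
    l1norm β - l1norm γ ≤ l1norm (sub0 S (γ - β)) - l1norm (sub0 Sᶜ (γ - β)) := by
  simp only [l1norm, ← Finset.sum_sub_distrib]
  refine Finset.sum_le_sum fun j _ => ?_
  by_cases hj : j ∈ S
  · simpa [sub0, hj, abs_sub_comm (γ j)] using abs_sub_abs_le_abs_sub (β j) (γ j)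
  · simp [sub0, hj, hS j hj]

lemma abs_le_lsup {p : ℕ} (v : Fin p → ℝ) (j : Fin p) : |v j| ≤ lsup v :=
  le_ciSup (f := fun j => |v j|) (Set.finite_range _).bddAbove j

lemma innerN_mulVec_le {n p : ℕ} (X : Matrix (Fin n) (Fin p) ℝ) (u : Fin n → ℝ)
    (δ : Fin p → ℝ) : innerN u (X.mulVec δ) ≤ lsup (Xᵀ.mulVec u) / n * l1norm δ := by
  have h : ∑ i, u i * X.mulVec δ i = ∑ j, Xᵀ.mulVec u j * δ j := by
    change u ⬝ᵥ X.mulVec δ = Xᵀ.mulVec u ⬝ᵥ δ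
    rw [Matrix.dotProduct_mulVec, Matrix.mulVec_transpose]
  rw [innerN, h, div_mul_eq_mul_div]
  gcongr
  rw [l1norm, Finset.mul_sum]
  refine Finset.sum_le_sum fun j _ => (le_abs_self _).trans ?_
  rw [abs_mul]
  exact mul_le_mul_of_nonneg_right (abs_le_lsup _ j) (abs_nonneg _)

lemma compatSq_mul_sq_le {n p : ℕ} (X : Matrix (Fin n) (Fin p) ℝ) {L : ℝ}
    {S : Finset (Fin p)} {δ : Fin p → ℝ} (ha : 0 < l1norm (sub0 S δ))
    (hb : l1norm (sub0 Sᶜ δ) ≤ L * l1norm (sub0 S δ)) :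
    compatSq X L S * l1norm (sub0 S δ) ^ 2 ≤ S.card * normN (X.mulVec δ) ^ 2 := by
  set a := l1norm (sub0 S δ) with ha'
  set γ : Fin p → ℝ := a⁻¹ • (sub0 S δ - sub0 Sᶜ δ) with hγ
  have h1 : sub0 S γ = a⁻¹ • sub0 S δ := by
    ext j
    by_cases hj : j ∈ S <;> simp [hγ, sub0, hj]
  have h2 : sub0 Sᶜ γ = (-a⁻¹) • sub0 Sᶜ δ := by
    ext j
    by_cases hj : j ∈ S <;> simp [hγ, sub0, hj]
  have h3 : X.mulVec (sub0 S γ) - X.mulVec (sub0 Sᶜ γ) = a⁻¹ • X.mulVec δ := by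
    rw [← Matrix.mulVec_sub, ← Matrix.mulVec_smul, h1, h2, neg_smul, sub_neg_eq_add, ← smul_add,
      sub0_add_compl]
  have hle : compatSq X L S ≤ S.card * normN (a⁻¹ • X.mulVec δ) ^ 2 := by
    refine csInf_le ⟨0, ?_⟩ ⟨γ, ?_, ?_, by rw [h3]⟩
    · rintro r ⟨_, _, _, rfl⟩
      positivity
    · rw [h1, l1norm_smul, abs_of_pos (inv_pos.2 ha), ← ha', inv_mul_cancel₀ ha.ne']
    · rw [h2, l1norm_smul, abs_neg, abs_of_pos (inv_pos.2 ha), inv_mul_le_iff₀ ha, mul_comm a]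
      exact hb
  rw [normN_smul_sq] at hle
  calc compatSq X L S * a ^ 2
      ≤ S.card * (a⁻¹ ^ 2 * normN (X.mulVec δ) ^ 2) * a ^ 2 := by gcongr
    _ = S.card * normN (X.mulVec δ) ^ 2 := by field_simp

/-- The scalar inequality behind the lower bound on the residual norm. -/
lemma mul_le_of_sq_sub_le {η lam lam0 e t d b b0 : ℝ} (hηsq : η ^ 2 = 1 - 2 * η)
    (hlam : 0 < lam) (hlam0 : 0 < lam0) (he : 0 ≤ e) (ht : 0 ≤ t)
    (hsq : e ^ 2 - 2 * (lam0 * e * d) ≤ t ^ 2) (hmin : t + lam * b ≤ e + lam * b0)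
    (hd : d ≤ b + b0) (hb0 : b0 * (2 * lam0 * lam) ≤ e * (lam * η - lam0)) : η * e ≤ t := by
  have h1 : lam * d ≤ 2 * (lam * b0) + e - t := by
    linarith [mul_le_mul_of_nonneg_left hd hlam.le]
  have h2 : lam * e ^ 2 - 2 * (lam0 * e * (2 * (lam * b0) + e - t)) ≤ lam * t ^ 2 := by
    linarith [mul_le_mul_of_nonneg_left h1 (mul_nonneg hlam0.le he),
      mul_le_mul_of_nonneg_left hsq hlam.le]
  have h3 : lam * (η * e) ^ 2 ≤ lam * t ^ 2 := by
    have h4 := mul_le_mul_of_nonneg_left hb0 he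
    have h5 : lam * (η * e) ^ 2 = lam * e ^ 2 - 2 * (lam * η * e ^ 2) := by
      rw [mul_pow, hηsq]
      ring
    have h6 : 0 ≤ lam0 * e * t := by positivity
    linarith
  exact le_of_abs_le ((sq_le_sq.1 (le_of_mul_le_mul_left h3 hlam)).trans_eq (abs_of_nonneg ht))

lemma le_div_mul_of_sub_mul_le {lam0 e u v a b : ℝ} (hlam0 : 0 ≤ lam0) (hv : lam0 < v)
    (he : 0 < e) (huv : v * e ≤ u) (ha : 0 ≤ a)
    (h : (u - lam0 * e) * b ≤ (u + lam0 * e) * a) :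
    b ≤ (v + lam0) / (v - lam0) * a := by
  have hgap : 0 < v - lam0 := sub_pos.2 hv
  have hgap' : 0 < u - lam0 * e := by linarith [mul_pos hgap he]
  rw [div_mul_eq_mul_div, le_div_iff₀ hgap]
  have h2 : 0 ≤ (u - v * e) * (lam0 * a) := mul_nonneg (by linarith) (by positivity)
  have h3 : (u - lam0 * e) * (b * (v - lam0)) ≤ (u - lam0 * e) * ((v + lam0) * a) := by
    linarith [mul_le_mul_of_nonneg_right h hgap.le]
  exact le_of_mul_le_mul_left h3 hgap'

lemma two_mul_le_add_of_mul_sq_le {q a s N K : ℝ} (hq : 0 < q) (ha : 0 < a) (hs : 0 ≤ s)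
    (h : q * a ^ 2 ≤ s * N) : 2 * (K * a) ≤ N + K ^ 2 * s / q := by
  have hs' : 0 < s := by
    refine hs.lt_of_ne fun h0 => ?_
    rw [← h0, zero_mul] at h
    exact absurd h (not_le.2 (by positivity))
  have h1 : q * a ^ 2 / s ≤ N := by rwa [div_le_iff₀ hs', mul_comm N]
  have h2 : 2 * (K * a) ≤ q * a ^ 2 / s + K ^ 2 * s / q := by
    rw [div_add_div _ _ hs'.ne' hq.ne', le_div_iff₀ (by positivity)]
    nlinarith [sq_nonneg (q * a - K * s)]
  linarith

/-- First-order optimality condition for the square-root Lasso. -/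
lemma innerN_residual_le {n p : ℕ} {X : Matrix (Fin n) (Fin p) ℝ} {Y : Fin n → ℝ} {lam : ℝ}
    (hlam : 0 ≤ lam) {βhat : Fin p → ℝ}
    (hβhat : ∀ β : Fin p → ℝ,
      normN (Y - X.mulVec βhat) + lam * l1norm βhat ≤ normN (Y - X.mulVec β) + lam * l1norm β)
    (hpos : 0 < normN (Y - X.mulVec βhat)) (β : Fin p → ℝ) :
    innerN (Y - X.mulVec βhat) (X.mulVec (β - βhat)) ≤
      lam * normN (Y - X.mulVec βhat) * (l1norm β - l1norm βhat) := by
  set r := Y - X.mulVec βhat with hr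
  set v := X.mulVec (β - βhat) with hv
  have key : ∀ τ : ℝ, 0 < τ → τ ≤ 1 →
      2 * innerN r v ≤ τ * normN v ^ 2 + 2 * lam * normN r * (l1norm β - l1norm βhat) := by
    intro τ h0 h1
    have hmin := hβhat ((1 - τ) • βhat + τ • β)
    have hl : l1norm ((1 - τ) • βhat + τ • β) ≤ (1 - τ) * l1norm βhat + τ * l1norm β := by
      refine (l1norm_add_le _ _).trans_eq ?_
      rw [l1norm_smul, l1norm_smul, abs_of_nonneg (sub_nonneg.2 h1), abs_of_pos h0]
    have hres : Y - X.mulVec ((1 - τ) • βhat + τ • β) = r - τ • v := by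
      rw [hr, hv, ← Matrix.mulVec_smul, sub_sub, ← Matrix.mulVec_add]
      congr 2
      module
    rw [hres] at hmin
    have hsq := normN_sub_sq r (τ • v)
    rw [innerN_comm, innerN_smul_left, innerN_comm v r, normN_smul_sq] at hsq
    have hstep : normN r ≤ normN (r - τ • v) + lam * (τ * (l1norm β - l1norm βhat)) := by
      nlinarith [mul_le_mul_of_nonneg_left hl hlam]
    have hmul := mul_le_mul_of_nonneg_left hstep hpos.le
    have hτ : τ * (2 * innerN r v) ≤
        τ * (τ * normN v ^ 2 + 2 * lam * normN r * (l1norm β - l1norm βhat)) := by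
      nlinarith [sq_nonneg (normN (r - τ • v) - normN r)]
    exact le_of_mul_le_mul_left hτ h0
  by_contra! hlt
  set d := innerN r v - lam * normN r * (l1norm β - l1norm βhat) with hd
  have hdpos : 0 < d := sub_pos.2 hlt
  have hk : 0 < normN v ^ 2 + d := by positivity
  have hτ := key (d / (normN v ^ 2 + d)) (by positivity)
    ((div_le_one hk).2 (by nlinarith [sq_nonneg (normN v)]))
  have hle : d / (normN v ^ 2 + d) * normN v ^ 2 ≤ d := by
    rw [div_mul_eq_mul_div, div_le_iff₀ hk]
    nlinarith
  linarith

theorem sqrt_lasso_oracle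
    {n p : ℕ} (X : Matrix (Fin n) (Fin p) ℝ) (Y : Fin n → ℝ)
    (β0 : Fin p → ℝ) (ε : Fin n → ℝ) (hε : ε = Y - X.mulVec β0)
    (lam : ℝ) (hlam0 : 0 < lam)
    (βhat : Fin p → ℝ)
    (hβhat : ∀ β : Fin p → ℝ,
      normN (Y - X.mulVec βhat) + lam * l1norm βhat ≤
        normN (Y - X.mulVec β) + lam * l1norm β)
    (lam0 : ℝ) (hlam0' : lam0 * normN ε ≥ lsup (Xᵀ.mulVec ε) / n)
    (η : ℝ) (hη : η = Real.sqrt 2 - 1)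
    (hlam : lam * η > lam0)
    (hβ0 : l1norm β0 ≤ normN ε * (lam * η - lam0) / (2 * lam0 * lam))
    (L : ℝ) (hL : L = (lam * η + lam0) / (lam * η - lam0))
    (β : Fin p → ℝ) (S : Finset (Fin p)) (hS : ∀ j, j ∈ S ↔ β j ≠ 0)
    (hφ : 0 < compatSq X L S) :
    (normN (X.mulVec (βhat - β0))) ^ 2 ≤
      (normN (X.mulVec (β - β0))) ^ 2 +
        ((lam * η + lam0) / η) ^ 2 * ((lam * η + lam0) / (2 * lam0)) ^ 2 *
          (normN ε) ^ 2 * S.card / compatSq X L S := by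
  have hηsq : η ^ 2 = 1 - 2 * η := by
    rw [hη]
    nlinarith [Real.sq_sqrt (show (0 : ℝ) ≤ 2 by norm_num)]
  have hη0 : 0 < η := by
    rw [hη, sub_pos, Real.lt_sqrt zero_le_one]
    norm_num
  have hη1 : η < 1 := by nlinarith
  have hholder : ∀ δ : Fin p → ℝ, innerN ε (X.mulVec δ) ≤ lam0 * normN ε * l1norm δ := fun δ =>
    (innerN_mulVec_le X ε δ).trans (mul_le_mul_of_nonneg_right hlam0' (l1norm_nonneg δ))
  have hres : Y - X.mulVec βhat = ε - X.mulVec (βhat - β0) := by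
    rw [hε, Matrix.mulVec_sub]
    abel
  have hmin0 := hβhat β0
  rw [← hε] at hmin0
  have hexp := normN_sub_sq ε (X.mulVec (βhat - β0))
  rw [← hres] at hexp
  have hh := hholder (βhat - β0)
  have hl1 := l1norm_sub_le βhat β0
  have he0 := normN_nonneg ε
  have ht0 := normN_nonneg (Y - X.mulVec βhat)
  have hb0 := l1norm_nonneg βhat
  rcases le_or_gt (lam0 * normN ε) 0 with hdeg | hnd
  · have hβ0z : l1norm β0 ≤ 0 := by
      refine hβ0.trans ?_
      rcases le_or_gt lam0 0 with h | h
      · exact div_nonpos_of_nonneg_of_nonpos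
          (mul_nonneg he0 (sub_nonneg.2 hlam.le)) (by nlinarith)
      · have : normN ε = 0 := le_antisymm (by nlinarith) he0
        simp [this]
    have h0 : l1norm β0 = 0 := le_antisymm hβ0z (l1norm_nonneg β0)
    rw [h0] at hmin0
    have hle : normN (Y - X.mulVec βhat) ≤ normN ε := by nlinarith
    have hneg : lam0 * normN ε * l1norm (βhat - β0) ≤ 0 :=
      mul_nonpos_of_nonpos_of_nonneg hdeg (l1norm_nonneg _)
    have hlhs : normN (X.mulVec (βhat - β0)) ^ 2 ≤ 0 := by nlinarith
    exact hlhs.trans (by positivity)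
  have he : 0 < normN ε := he0.lt_of_ne fun h => by simp [← h] at hnd
  have hl0 : 0 < lam0 := pos_of_mul_pos_left hnd he0
  have hβ0' : l1norm β0 * (2 * lam0 * lam) ≤ normN ε * (lam * η - lam0) :=
    (le_div_iff₀ (by positivity)).1 hβ0
  set e := normN ε
  set t := normN (Y - X.mulVec βhat)
  have hlow : η * e ≤ t :=
    mul_le_of_sq_sub_le hηsq hlam0 hl0 he0 ht0
      (by linarith [sq_nonneg (normN (X.mulVec (βhat - β0)))]) hmin0 hl1 hβ0'
  have hup : 2 * lam0 * t ≤ e * (lam * η + lam0) := by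
    have h1 : t ≤ e + lam * l1norm β0 := by nlinarith
    nlinarith [mul_le_mul_of_nonneg_left h1 hl0.le]
  have htpos : 0 < t := (mul_pos hη0 he).trans_le hlow
  have hkkt := innerN_residual_le hlam0.le hβhat htpos β
  have hdec := l1norm_sub_l1norm_le (S := S) (β := β)
    (fun j hj => by simpa using mt (hS j).2 hj) βhat
  have hsplit := l1norm_sub0_add_compl S (βhat - β)
  have hhβ := hholder (βhat - β)
  set a := l1norm (sub0 S (βhat - β)) with ha_def
  set b := l1norm (sub0 Sᶜ (βhat - β))
  have ha0 : 0 ≤ a := l1norm_nonneg _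
  have hbn : 0 ≤ b := l1norm_nonneg _
  have hpol : normN (X.mulVec (β - β0)) ^ 2 = normN (X.mulVec (βhat - β0)) ^ 2
      - 2 * innerN (X.mulVec (βhat - β0)) (X.mulVec (βhat - β))
      + normN (X.mulVec (βhat - β)) ^ 2 := by
    rw [← normN_sub_sq, ← Matrix.mulVec_sub]
    congr 3
    abel
  set I := innerN (X.mulVec (βhat - β0)) (X.mulVec (βhat - β))
  have hI : I ≤ (lam * t + lam0 * e) * a - (lam * t - lam0 * e) * b := by
    have h1 : innerN (Y - X.mulVec βhat) (X.mulVec (β - βhat)) =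
        I - innerN ε (X.mulVec (βhat - β)) := by
      have h2 : X.mulVec (β - βhat) = (-1 : ℝ) • X.mulVec (βhat - β) := by
        rw [← Matrix.mulVec_smul]
        congr 1
        module
      rw [h2, innerN_comm, innerN_smul_left, innerN_comm, hres, innerN_sub_left]
      ring
    rw [h1] at hkkt
    rw [← hsplit] at hhβ
    have h3 : lam * t * (l1norm β - l1norm βhat) ≤ lam * t * (a - b) :=
      mul_le_mul_of_nonneg_left hdec (by positivity)
    linarith
  have hN := sq_nonneg (normN (X.mulVec (βhat - β)))
  rcases le_or_gt I 0 with hIneg | hIpos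
  · have : 0 ≤ ((lam * η + lam0) / η) ^ 2 * ((lam * η + lam0) / (2 * lam0)) ^ 2 *
        e ^ 2 * S.card / compatSq X L S := by positivity
    linarith
  have hlt : lam * η * e ≤ lam * t := by
    linarith [mul_le_mul_of_nonneg_left hlow hlam0.le]
  have hgap : 0 < lam * η - lam0 := sub_pos.2 hlam
  have hgap' : 0 < lam * t - lam0 * e := by linarith [mul_pos hgap he]
  have hapos : 0 < a := by
    refine ha0.lt_of_ne fun h => ?_
    rw [← h] at hI
    linarith [mul_nonneg hgap'.le hbn]
  have hba : b ≤ L * a := by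
    rw [hL]
    exact le_div_mul_of_sub_mul_le hl0.le hlam he hlt ha0 (by linarith)
  have hcompat := compatSq_mul_sq_le X hapos hba
  rw [← ha_def] at hcompat
  set q := compatSq X L S
  set K := lam * t + lam0 * e with hK_def
  have hK0 : 0 ≤ K := by positivity
  have hIK : I ≤ K * a := by linarith [mul_nonneg hgap'.le hbn]
  have hKle : K ≤ (lam * η + lam0) / η * ((lam * η + lam0) / (2 * lam0)) * e := by
    rw [div_mul_div_comm, div_mul_eq_mul_div, le_div_iff₀ (by positivity)]
    have h1 := mul_le_mul_of_nonneg_left hup (by positivity : 0 ≤ lam * η)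
    have h2 : 0 ≤ e * lam0 * (lam * η - lam0) := by positivity
    have h3 : 0 ≤ e * lam0 ^ 2 * (1 - η) := mul_nonneg (by positivity) (by linarith)
    rw [hK_def]
    linarith
  have hmain : 2 * (K * a) ≤ normN (X.mulVec (βhat - β)) ^ 2 + K ^ 2 * S.card / q :=
    two_mul_le_add_of_mul_sq_le hφ hapos (Nat.cast_nonneg _) hcompat
  have hKsq : K ^ 2 ≤
      ((lam * η + lam0) / η * ((lam * η + lam0) / (2 * lam0)) * e) ^ 2 := by gcongr
  have hfin : K ^ 2 * S.card / q ≤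
      ((lam * η + lam0) / η) ^ 2 * ((lam * η + lam0) / (2 * lam0)) ^ 2 * e ^ 2 * S.card / q := by
    rw [← mul_pow, ← mul_pow]
    gcongr
  linarith
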